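/- There exists an idempotent harmonic ultrafilter: an ultrafilter p on ℕ all of whose members are harmonic sets and which satisfies p + p = p for the Glazer addition (the semigroup operation on Ultrafilter ℕ extending addition on ℕ). -/

import Mathlib

/-- A set `A ⊆ ℕ` is harmonic if the series of reciprocals of its elements diverges. -/
def Harmonic (A : Set ℕ) : Prop :=
  ¬ Summable (fun a : A => (1 : ℝ) / (a : ℝ))

theorem not_harmonic_iff_summable_indicator {A : Set ℕ} :
    ¬ Harmonic A ↔ Summable (A.indicator fun n : ℕ => (1 : ℝ) / n) := by
  rw [Harmonic, not_not, ← summable_subtype_iff_indicator]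
  rfl

theorem Harmonic.mono {A B : Set ℕ} (h : A ⊆ B) (hA : Harmonic A) : Harmonic B := by
  by_contra hB
  rw [not_harmonic_iff_summable_indicator] at hB
  refine not_harmonic_iff_summable_indicator.2 (hB.of_nonneg_of_le ?_ ?_) hA
  · exact fun n => Set.indicator_nonneg (fun _ _ => by positivity) n
  · exact fun n => Set.indicator_le_indicator_of_subset h (fun _ => by positivity) n

theorem not_harmonic_union {A B : Set ℕ} (hA : ¬ Harmonic A) (hB : ¬ Harmonic B) :
    ¬ Harmonic (A ∪ B) := by
  rw [not_harmonic_iff_summable_indicator] at *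
  refine (hA.add hB).of_nonneg_of_le
    (fun n => Set.indicator_nonneg (fun _ _ => by positivity) n) fun n => ?_
  have : (0 : ℝ) ≤ 1 / n := by positivity
  by_cases h₁ : n ∈ A <;> by_cases h₂ : n ∈ B <;> simp_all

theorem harmonic_univ : Harmonic Set.univ := by
  by_contra h
  rw [not_harmonic_iff_summable_indicator, Set.indicator_univ] at h
  exact Real.not_summable_one_div_natCast h

/-- A translate `{n | m + n ∈ A}` is harmonic only if `A` is. -/
theorem Harmonic.of_preimage_add_left {A : Set ℕ} (m : ℕ) (h : Harmonic {n | m + n ∈ A}) :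
    Harmonic A := by
  by_contra hA
  rw [not_harmonic_iff_summable_indicator] at hA
  have hs := (hA.comp_injective (add_right_injective m)).mul_left ((m : ℝ) + 1)
  refine not_harmonic_iff_summable_indicator.2 (hs.of_nonneg_of_le
    (fun n => Set.indicator_nonneg (fun _ _ => by positivity) n) fun n => ?_) h
  by_cases hn : m + n ∈ A
  · rw [Set.indicator_of_mem (show n ∈ {n | m + n ∈ A} from hn), Function.comp_apply,
      Set.indicator_of_mem hn]
    rcases Nat.eq_zero_or_pos n with rfl | hpos
    · simp only [Nat.cast_zero, div_zero]
      positivity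
    · have h₁ : (1 : ℝ) ≤ n := by exact_mod_cast hpos
      have h₀ : (0 : ℝ) ≤ m := m.cast_nonneg
      push_cast
      rw [mul_one_div, div_le_div_iff₀ (by linarith) (by linarith)]
      nlinarith
  · rw [Set.indicator_of_notMem (show n ∉ {n | m + n ∈ A} from hn), Function.comp_apply,
      Set.indicator_of_notMem hn, mul_zero]

theorem exists_ultrafilter_harmonic : ∃ p : Ultrafilter ℕ, ∀ A ∈ p, Harmonic A := by
  let F : Filter ℕ := Filter.comk (fun A => ¬ Harmonic A)
    (by rw [not_harmonic_iff_summable_indicator, Set.indicator_empty]; exact summable_zero)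
    (fun _ hB _ hAB hA => hB (hA.mono hAB)) (fun _ hA _ hB => not_harmonic_union hA hB)
  have : F.NeBot := Filter.neBot_iff.2 fun h => by
    have h_empty : ∅ ∈ F := h ▸ Filter.mem_bot
    rw [Filter.mem_comk, Set.compl_empty] at h_empty
    exact h_empty harmonic_univ
  obtain ⟨p, hp⟩ := F.exists_ultrafilter_le
  refine ⟨p, fun A hA => ?_⟩
  by_contra h
  refine Ultrafilter.compl_mem_iff_notMem.1 (hp ?_) hA
  rwa [Filter.mem_comk, compl_compl]

theorem isClosed_setOf_forall_mem_harmonic :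
    IsClosed {p : Ultrafilter ℕ | ∀ A ∈ p, Harmonic A} := by
  have : {p : Ultrafilter ℕ | ∀ A ∈ p, Harmonic A} =
      ⋂ (A : Set ℕ) (_ : ¬ Harmonic A), {p : Ultrafilter ℕ | A ∈ p}ᶜ := by
    ext p
    simp only [Set.mem_iInter, Set.mem_compl_iff]
    exact forall_congr' fun A => not_imp_not.symm
  rw [this]
  exact isClosed_biInter fun A _ => (ultrafilter_isOpen_basic A).isClosed_compl

attribute [local instance] Ultrafilter.addSemigroup

/-- There is an idempotent harmonic ultrafilter: an ultrafilter `p` on `ℕ` all of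
whose members are harmonic and which satisfies `p + p = p` for the Glazer addition,
expressed via membership: `A ∈ p` iff `{x | {y | y + x ∈ A} ∈ p} ∈ p`. -/
theorem exists_idempotent_harmonic_ultrafilter :
    ∃ p : Ultrafilter ℕ, (∀ A ∈ p, Harmonic A) ∧
      ∀ A : Set ℕ, (A ∈ p ↔ {x : ℕ | {y : ℕ | y + x ∈ A} ∈ p} ∈ p) := by
  obtain ⟨p, hp, hpp⟩ := exists_idempotent_in_compact_add_subsemigroup
    Ultrafilter.continuous_add_left {p : Ultrafilter ℕ | ∀ A ∈ p, Harmonic A}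
    exists_ultrafilter_harmonic isClosed_setOf_forall_mem_harmonic.isCompact
    fun p _ q hq A hA => by
      obtain ⟨m, hm⟩ := ((Ultrafilter.eventually_add p q (· ∈ A)).1 hA).exists
      exact Harmonic.of_preimage_add_left m (hq _ hm)
  refine ⟨p, hp, fun A => ?_⟩
  have h : A ∈ p + p ↔ {x | {y | x + y ∈ A} ∈ p} ∈ p := Iff.rfl
  rw [hpp] at h
  simpa only [add_comm] using h
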